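/- Let 𝔄 be a subshift, (G,+) an abelian group, and d ∈ {1,…,D}. If a ∈ 𝔄̃ has a projective (G,d)-pole, then the defect of a is essential. -/

import Mathlib

open scoped ENNReal

namespace Defects

/-- The configuration space `A^(ℤ^D)`. -/
abbrev Config (D : ℕ) (A : Type) := (Fin D → ℤ) → A

variable {D : ℕ} {A : Type}

/-- The shift `σ^v`. -/
def shift (v : Fin D → ℤ) (a : Config D A) : Config D A := fun z => a (z + v)

/-- A subshift: a nonempty closed shift-invariant subset of `A^(ℤ^D)`. -/
def IsSubshift [TopologicalSpace A] (𝔄 : Set (Config D A)) : Prop :=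
  𝔄.Nonempty ∧ IsClosed 𝔄 ∧ ∀ v : Fin D → ℤ, shift v '' 𝔄 = 𝔄

/-- The cube `B(r) = [-r, r]^D ⊆ ℤ^D`. -/
def ballZ (D r : ℕ) : Set (Fin D → ℤ) := {w | ∀ i, |w i| ≤ (r : ℤ)}

/-- The `r`-block of `a` at `z`, as an element of `A^(B(r))`. -/
def blockAt (r : ℕ) (a : Config D A) (z : Fin D → ℤ) : ballZ D r → A :=
  fun w => a (z + w.1)

/-- The set `𝔄_(r)` of admissible `r`-blocks. -/
def admissibleBlocks (𝔄 : Set (Config D A)) (r : ℕ) : Set (ballZ D r → A) :=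
  (fun a => blockAt r a 0) '' 𝔄

/-- `G_R(a)`: the set of `z` where the `R`-block of `a` is admissible. -/
def goodSet (𝔄 : Set (Config D A)) (R : ℕ) (a : Config D A) : Set (Fin D → ℤ) :=
  {z | blockAt R a z ∈ admissibleBlocks 𝔄 R}

/-- `𝔄̃`: configurations having arbitrarily large admissible regions. -/
def almostAdmissible (𝔄 : Set (Config D A)) : Set (Config D A) :=
  {a | ∀ R : ℕ, (goodSet 𝔄 R a).Nonempty}

/-- The defect of `a` is removable if some `a' ∈ 𝔄` agrees with `a` on `G_r(a)`. -/
def Removable (𝔄 : Set (Config D A)) (a : Config D A) : Prop :=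
  ∃ r : ℕ, ∃ a' ∈ 𝔄, ∀ z ∈ goodSet 𝔄 r a, a' z = a z

/-- A cellular automaton: continuous and commuting with all shifts. -/
def IsCellularAutomaton [TopologicalSpace A] (Φ : Config D A → Config D A) : Prop :=
  Continuous Φ ∧ ∀ v : Fin D → ℤ, Φ ∘ shift v = shift v ∘ Φ

/-- `Φ` has radius `R`: `Φ(a)(z)` depends only on the `R`-block of `a` at `z`. -/
def HasRadius {B : Type} (Φ : Config D A → Config D B) (R : ℕ) : Prop :=
  ∀ a b : Config D A, ∀ z : Fin D → ℤ, blockAt R a z = blockAt R b z → Φ a z = Φ b z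

/-- `E = {±e_1, …, ±e_D}`. -/
def stdSteps (D : ℕ) : Set (Fin D → ℤ) :=
  {v | ∃ i : Fin D, v = Pi.single i 1 ∨ v = -Pi.single i 1}

/-- A subshift homomorphism `Φ : 𝔄 → 𝔅`. -/
def IsSubshiftHom {B : Type} [TopologicalSpace A] [TopologicalSpace B]
    (𝔄 : Set (Config D A)) (𝔅 : Set (Config D B)) (Φ : Config D A → Config D B) : Prop :=
  Set.MapsTo Φ 𝔄 𝔅 ∧ ContinuousOn Φ 𝔄 ∧
    ∀ v : Fin D → ℤ, ∀ a ∈ 𝔄, Φ (shift v a) = shift v (Φ a)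

/-- `Φ` has radius `R` as a map on `𝔄`. -/
def HomHasRadius {B : Type} (𝔄 : Set (Config D A)) (Φ : Config D A → Config D B)
    (R : ℕ) : Prop :=
  ∀ a ∈ 𝔄, ∀ a' ∈ 𝔄, ∀ z : Fin D → ℤ, blockAt R a z = blockAt R a' z → Φ a z = Φ a' z

/-! ### Dynamical cocycles (multiplicative) -/

/-- A continuous `G`-valued (dynamical) cocycle on `𝔄`. -/
def DynCocycleOn [TopologicalSpace A] {G : Type} [Group G] [TopologicalSpace G] (𝔄 : Set (Config D A))
    (C : (Fin D → ℤ) → Config D A → G) : Prop :=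
  (∀ z : Fin D → ℤ, ContinuousOn (C z) 𝔄) ∧
    ∀ y z : Fin D → ℤ, ∀ a ∈ 𝔄, C (y + z) a = C y (shift z a) * C z a

/-- Cohomologous cocycles, via a continuous transfer function. -/
def DynCohomologous [TopologicalSpace A] {G : Type} [Group G] [TopologicalSpace G] (𝔄 : Set (Config D A))
    (C C' : (Fin D → ℤ) → Config D A → G) : Prop :=
  ∃ b : Config D A → G, ContinuousOn b 𝔄 ∧
    ∀ z : Fin D → ℤ, ∀ a ∈ 𝔄, C' z a = b (shift z a) * C z a * (b a)⁻¹

/-- A trivial cocycle: cohomologous to a homomorphism `ℤ^D → G`. -/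
def DynTrivial [TopologicalSpace A] {G : Type} [Group G] [TopologicalSpace G] (𝔄 : Set (Config D A))
    (C : (Fin D → ℤ) → Config D A → G) : Prop :=
  ∃ h : (Fin D → ℤ) → G, (∀ y z : Fin D → ℤ, h (y + z) = h y * h z) ∧
    DynCohomologous 𝔄 C (fun z _ => h z)

/-- A cocycle is locally determined with radius `r` if `C(e, ·)` (for `e ∈ E`)
depends only on the `r`-block at `0`. -/
def LocallyDetermined {G : Type} [Group G] (𝔅 : Set (Config D A))
    (C : (Fin D → ℤ) → Config D A → G) (r : ℕ) : Prop :=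
  ∀ e ∈ stdSteps D, ∀ b ∈ 𝔅, ∀ b' ∈ 𝔅,
    blockAt r b 0 = blockAt r b' 0 → C e b = C e b'

/-- A fundamental cocycle: every continuous cocycle into a discrete group is
cohomologous to a homomorphic image of `Cstar`. -/
def IsFundamental [TopologicalSpace A] {Gs : Type} [Group Gs] [TopologicalSpace Gs] (𝔄 : Set (Config D A))
    (Cstar : (Fin D → ℤ) → Config D A → Gs) : Prop :=
  ∀ (H : Type) [Group H] [TopologicalSpace H] [DiscreteTopology H],
    ∀ C : (Fin D → ℤ) → Config D A → H,
      DynCocycleOn 𝔄 C → ∃ ψ : Gs →* H, DynCohomologous 𝔄 C fun z a => ψ (Cstar z a)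


/-! ### Trails and locally determined cocycles via local rules -/

/-- A trail: a nonempty sequence in `ℤ^D` whose successive steps lie in `E`. -/
def IsTrail (ζ : List (Fin D → ℤ)) : Prop :=
  ζ ≠ [] ∧ ζ.Chain' fun x y => y - x ∈ stdSteps D

/-- The trail `ζ` lies in `Y`. -/
def TrailIn (Y : Set (Fin D → ℤ)) (ζ : List (Fin D → ℤ)) : Prop := ∀ z ∈ ζ, z ∈ Y

/-- A closed trail: the first and last points coincide. -/
def IsClosedTrail (ζ : List (Fin D → ℤ)) : Prop := ζ.head? = ζ.getLast?

/-- Concatenation of trails (the final point of `ζ` should equal the initial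
point of `ξ`). -/
def trailConcat (ζ ξ : List (Fin D → ℤ)) : List (Fin D → ℤ) := ζ ++ ξ.tail

/-- The value `c(ζ, a)` of a local rule along a trail, later steps multiplied
on the left. -/
def trailVal {G : Type} [Group G] {r : ℕ} (c : (Fin D → ℤ) → (ballZ D r → A) → G)
    (a : Config D A) : List (Fin D → ℤ) → G
  | [] => 1
  | [_] => 1
  | x :: y :: rest => trailVal c a (y :: rest) * c (y - x) (blockAt r a x)

/-- A local rule of radius `r` for a `G`-valued cocycle on `𝔄`. -/
def IsLocalRule {G : Type} [Group G] (𝔄 : Set (Config D A)) (r : ℕ)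
    (c : (Fin D → ℤ) → (ballZ D r → A) → G) : Prop :=
  ∀ a : Config D A, ∀ e ∈ stdSteps D, ∀ e' ∈ stdSteps D,
    ((0 ∈ goodSet 𝔄 r a ∧ e ∈ goodSet 𝔄 r a ∧ e' ∈ goodSet 𝔄 r a ∧
        e + e' ∈ goodSet 𝔄 r a) →
      c e' (blockAt r a e) * c e (blockAt r a 0) =
        c e (blockAt r a e') * c e' (blockAt r a 0)) ∧
    ((0 ∈ goodSet 𝔄 r a ∧ e ∈ goodSet 𝔄 r a) →
      c (-e) (blockAt r a e) = (c e (blockAt r a 0))⁻¹)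

/-- Elementary `Y`-homotopies of trails. -/
inductive ElemHomotopy (Y : Set (Fin D → ℤ)) :
    List (Fin D → ℤ) → List (Fin D → ℤ) → Prop
  | slide (pre post : List (Fin D → ℤ)) (x y z : Fin D → ℤ)
      (hxy : y - x ∈ stdSteps D) (hyz : z - y ∈ stdSteps D) (hw : x + z - y ∈ Y) :
      ElemHomotopy Y (pre ++ x :: y :: z :: post) (pre ++ x :: (x + z - y) :: z :: post)
  | delBacktrack (pre post : List (Fin D → ℤ)) (x y : Fin D → ℤ)
      (hstep : y - x ∈ stdSteps D) :
      ElemHomotopy Y (pre ++ x :: y :: x :: post) (pre ++ x :: post)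
  | insBacktrack (pre post : List (Fin D → ℤ)) (x y : Fin D → ℤ)
      (hy : y ∈ Y) (hstep : y - x ∈ stdSteps D) :
      ElemHomotopy Y (pre ++ x :: post) (pre ++ x :: y :: x :: post)

/-- Two trails are `Y`-homotopic if joined by a finite chain of elementary
`Y`-homotopies. -/
def TrailHomotopic (Y : Set (Fin D → ℤ)) : List (Fin D → ℤ) → List (Fin D → ℤ) → Prop :=
  Relation.ReflTransGen fun p q => ElemHomotopy Y p q ∨ ElemHomotopy Y q p

/-- Points `z`, `y` joined by a trail lying in `Y`. -/
def TrailConnIn (Y : Set (Fin D → ℤ)) (z y : Fin D → ℤ) : Prop :=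
  ∃ (ζ : List (Fin D → ℤ)) (h : ζ ≠ []),
    IsTrail ζ ∧ TrailIn Y ζ ∧ ζ.head h = z ∧ ζ.getLast h = y

/-- `a` has a projective `c`-pole: for every `R ≥ r` there is a closed trail in
`G_R(a)` with nontrivial value. -/
def HasProjPole {G : Type} [Group G] (𝔄 : Set (Config D A)) (r : ℕ)
    (c : (Fin D → ℤ) → (ballZ D r → A) → G) (a : Config D A) : Prop :=
  ∀ R : ℕ, r ≤ R → ∃ ζ : List (Fin D → ℤ),
    IsTrail ζ ∧ IsClosedTrail ζ ∧ TrailIn (goodSet 𝔄 R a) ζ ∧ trailVal c a ζ ≠ 1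

/-- Restriction of a `ρ`-block to an `r`-block (`r ≤ ρ`). -/
def restrictBlock {r ρ : ℕ} (h : r ≤ ρ) (p : ballZ D ρ → A) : ballZ D r → A :=
  fun w => p ⟨w.1, by
    intro i
    exact le_trans (w.2 i) (by exact_mod_cast h)⟩

/-- The lift of a local rule of radius `r` to radius `ρ ≥ r`. -/
def liftRule {G : Type} [Group G] {r ρ : ℕ} (h : r ≤ ρ)
    (c : (Fin D → ℤ) → (ballZ D r → A) → G) :
    (Fin D → ℤ) → (ballZ D ρ → A) → G :=
  fun e p => c e (restrictBlock h p)

/-- Local rules of radius `ρ` are locally cohomologous via a local transfer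
function of some radius `s ≤ ρ`. -/
def LocallyCohomologous {G : Type} [Group G] (𝔄 : Set (Config D A)) (ρ : ℕ)
    (c₁ c₂ : (Fin D → ℤ) → (ballZ D ρ → A) → G) : Prop :=
  ∃ (s : ℕ) (_ : s ≤ ρ) (b : (ballZ D s → A) → G),
    ∀ a : Config D A, ∀ e ∈ stdSteps D,
      (0 ∈ goodSet 𝔄 ρ a ∧ e ∈ goodSet 𝔄 ρ a) →
      c₂ e (blockAt ρ a 0) = b (blockAt s a e) * c₁ e (blockAt ρ a 0) *
        (b (blockAt s a 0))⁻¹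

/-- Extend a block to a configuration (arbitrarily outside the block). -/
noncomputable def blockExtend [Nonempty A] {ρ : ℕ} (p : ballZ D ρ → A) : Config D A :=
  fun z => @dite A (z ∈ ballZ D ρ) (Classical.propDecidable _)
    (fun h => p ⟨z, h⟩) (fun _ => Classical.arbitrary A)

/-- The block map `Φ̄ : 𝔄_(r+R) → 𝔄_(r)` induced by a CA `Φ` of radius `R`. -/
noncomputable def blockMapCA [Nonempty A] (Φ : Config D A → Config D A) (R r : ℕ)
    (p : ballZ D (r + R) → A) : ballZ D r → A :=
  blockAt r (Φ (blockExtend p)) 0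

/-- The pullback local rule `Φ_* c` of radius `r + R`. -/
noncomputable def pullRule [Nonempty A] {G : Type} [Group G]
    (Φ : Config D A → Config D A) (R r : ℕ)
    (c : (Fin D → ℤ) → (ballZ D r → A) → G) :
    (Fin D → ℤ) → (ballZ D (r + R) → A) → G :=
  fun e p => c e (blockMapCA Φ R r p)

/-- Two local rules (of radii `r₁`, `r₂`) define the same class in
`H¹_loc(𝔄, G)`. -/
def SameHlocClass {G : Type} [CommGroup G] (𝔄 : Set (Config D A)) {r₁ r₂ : ℕ}
    (c₁ : (Fin D → ℤ) → (ballZ D r₁ → A) → G)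
    (c₂ : (Fin D → ℤ) → (ballZ D r₂ → A) → G) : Prop :=
  ∃ (ρ : ℕ) (h₁ : r₁ ≤ ρ) (h₂ : r₂ ≤ ρ) (h : (Fin D → ℤ) → G),
    (∀ y z : Fin D → ℤ, h (y + z) = h y * h z) ∧
    LocallyCohomologous 𝔄 ρ (liftRule h₁ c₁) fun e p => liftRule h₂ c₂ e p * h e

/-- `a` has a projective `G`-pole: a projective `c`-pole for some `G`-valued
local rule `c` of some radius. -/
def HasProjGPole (G : Type) [Group G] (𝔄 : Set (Config D A)) (a : Config D A) : Prop :=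
  ∃ (r : ℕ) (c : (Fin D → ℤ) → (ballZ D r → A) → G),
    IsLocalRule 𝔄 r c ∧ HasProjPole 𝔄 r c a

/-- A locally fundamental local rule (valued in a discrete abelian group). -/
def IsLocallyFundamental {Gs : Type} [CommGroup Gs] (𝔄 : Set (Config D A)) (rstar : ℕ)
    (cstar : (Fin D → ℤ) → (ballZ D rstar → A) → Gs) : Prop :=
  ∀ (H : Type) [CommGroup H], ∀ (r : ℕ) (c : (Fin D → ℤ) → (ballZ D r → A) → H),
    IsLocalRule 𝔄 r c →
    ∃ (ψ : Gs →* H) (ρ : ℕ) (h₁ : rstar ≤ ρ) (h₂ : r ≤ ρ),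
      LocallyCohomologous 𝔄 ρ (liftRule h₁ fun e p => ψ (cstar e p)) (liftRule h₂ c)

/-- A pseudonorm on `G`, with values in `[0, ∞]`. -/
def IsPseudonorm {G : Type} [Group G] (ν : G → ℝ≥0∞) : Prop :=
  ν 1 = 0 ∧ (∀ g h : G, ν (g * h) = ν (h * g)) ∧ ∀ g h : G, ν (g * h) ≤ ν g + ν h

/-- The `ℓ¹`-norm on `ℤ^D`. -/
def l1norm {D : ℕ} (v : Fin D → ℤ) : ℕ := ∑ i, (v i).natAbs


/-! ### Additive dynamical and equivariant cocycles -/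

/-- A continuous `(G,+)`-valued dynamical cocycle on `𝔄`. -/
def AddDynCocycleOn [TopologicalSpace A] {G : Type} [AddCommGroup G] [TopologicalSpace G]
    (𝔄 : Set (Config D A)) (C : (Fin D → ℤ) → Config D A → G) : Prop :=
  (∀ z : Fin D → ℤ, ContinuousOn (C z) 𝔄) ∧
    ∀ y z : Fin D → ℤ, ∀ a ∈ 𝔄, C (y + z) a = C y (shift z a) + C z a

/-- Cohomologous additive cocycles. -/
def AddDynCohomologous [TopologicalSpace A] {G : Type} [AddCommGroup G] [TopologicalSpace G]
    (𝔄 : Set (Config D A)) (C C' : (Fin D → ℤ) → Config D A → G) : Prop :=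
  ∃ b : Config D A → G, ContinuousOn b 𝔄 ∧
    ∀ z : Fin D → ℤ, ∀ a ∈ 𝔄, C' z a = b (shift z a) + C z a - b a

/-- The equivariant edge cocycle `Ψ(C̃)(x→y; a) = C̃(y−x, σ^x(a))` associated to a
dynamical cocycle. -/
def edgeCocycleOf {G : Type} [AddCommGroup G] (C : (Fin D → ℤ) → Config D A → G) :
    (Fin D → ℤ) → (Fin D → ℤ) → Config D A → G :=
  fun x y a => C (y - x) (shift x a)

/-- A continuous equivariant 1-cocycle on `𝔄` (as a function of oriented edges
`x → y`, i.e. pairs with `y - x ∈ E`). -/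
def IsEqCocycle [TopologicalSpace A] {G : Type} [AddCommGroup G] [TopologicalSpace G]
    (𝔄 : Set (Config D A)) (C : (Fin D → ℤ) → (Fin D → ℤ) → Config D A → G) : Prop :=
  (∀ x y : Fin D → ℤ, y - x ∈ stdSteps D → ContinuousOn (C x y) 𝔄) ∧
  (∀ x y z : Fin D → ℤ, y - x ∈ stdSteps D → ∀ a ∈ 𝔄,
      C x y (shift z a) = C (x + z) (y + z) a) ∧
  (∀ x y : Fin D → ℤ, y - x ∈ stdSteps D → ∀ a ∈ 𝔄, C y x a = -C x y a) ∧
  (∀ s : Fin D → ℤ, ∀ i j : Fin D, i ≠ j → ∀ a ∈ 𝔄,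
      C s (s + Pi.single i 1) a +
        C (s + Pi.single i 1) (s + Pi.single i 1 + Pi.single j 1) a =
      C s (s + Pi.single j 1) a +
        C (s + Pi.single j 1) (s + Pi.single i 1 + Pi.single j 1) a)

/-- Cohomologous equivariant 1-cocycles, via an equivariant continuous
0-cochain `B`. -/
def EqCohomologous [TopologicalSpace A] {G : Type} [AddCommGroup G] [TopologicalSpace G]
    (𝔄 : Set (Config D A)) (C C' : (Fin D → ℤ) → (Fin D → ℤ) → Config D A → G) : Prop :=
  ∃ B : (Fin D → ℤ) → Config D A → G,
    (∀ x : Fin D → ℤ, ContinuousOn (B x) 𝔄) ∧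
    (∀ x z : Fin D → ℤ, ∀ a ∈ 𝔄, B x (shift z a) = B (x + z) a) ∧
    ∀ x y : Fin D → ℤ, y - x ∈ stdSteps D → ∀ a ∈ 𝔄,
      C' x y a = B y a + C x y a - B x a

/-! ### Cells, chains, and equivariant `d`-cocycles -/

/-- A cell in `ℤ^D`: a base point together with a set of spanning directions. -/
abbrev Cell (D : ℕ) := (Fin D → ℤ) × Finset (Fin D)

/-- Chains: finitely supported `ℤ`-valued functions on cells. -/
abbrev CellChain (D : ℕ) := Cell D →₀ ℤ

/-- The boundary of a single cell. -/
noncomputable def cellBoundary {D : ℕ} (cell : Cell D) : CellChain D :=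
  ∑ i ∈ cell.2, ((-1 : ℤ) ^ (cell.2.filter fun j => j < i).card) •
    (Finsupp.single (cell.1 + Pi.single i 1, cell.2.erase i) (1 : ℤ) -
      Finsupp.single (cell.1, cell.2.erase i) (1 : ℤ))

/-- The boundary homomorphism on chains. -/
noncomputable def chainBoundary {D : ℕ} (ζ : CellChain D) : CellChain D :=
  ζ.sum fun cell n => n • cellBoundary cell

/-- The value of an equivariant cochain (of radius `r`) on a chain. -/
def chainVal {G : Type} [AddCommGroup G] {r : ℕ}
    (c : Finset (Fin D) → (ballZ D r → A) → G) (a : Config D A) (ζ : CellChain D) : G :=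
  ζ.sum fun cell n => n • c cell.2 (blockAt r a cell.1)

/-- An equivariant `d`-cocycle of radius `r` on `𝔄`: vanishes on boundaries of
`(d+1)`-cells over admissible configurations. -/
def IsEqDCocycle {G : Type} [AddCommGroup G] (𝔄 : Set (Config D A)) (d r : ℕ)
    (c : Finset (Fin D) → (ballZ D r → A) → G) : Prop :=
  ∀ a ∈ 𝔄, ∀ cell : Cell D, cell.2.card = d + 1 →
    chainVal c a (cellBoundary cell) = 0

/-- `a` has a projective `(G,d)`-pole. -/
def HasProjDPole (G : Type) [AddCommGroup G] (𝔄 : Set (Config D A)) (d : ℕ)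
    (a : Config D A) : Prop :=
  ∃ (r : ℕ) (c : Finset (Fin D) → (ballZ D r → A) → G),
    IsEqDCocycle 𝔄 d r c ∧
    ∀ R : ℕ, r ≤ R → ∃ ζ : CellChain D,
      (∀ cell ∈ ζ.support, (cell : Cell D).2.card = d) ∧
      chainBoundary ζ = 0 ∧
      (∀ cell ∈ ζ.support, (cell : Cell D).1 ∈ goodSet 𝔄 R a) ∧
      chainVal c a ζ ≠ 0

/-! ### Discrete antiderivatives -/

/-- The antiderivative of `u : ℤ → M` vanishing at `0`. -/
def antiderivative {M : Type} [AddCommGroup M] (u : ℤ → M) (k : ℤ) : M :=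
  ∑ j ∈ Finset.range k.toNat, u j - ∑ j ∈ Finset.range (-k).toNat, u (-1 - j)

section Antiderivative

variable {M N : Type} [AddCommGroup M] [AddCommGroup N]

theorem antiderivative_succ (u : ℤ → M) (k : ℤ) :
    antiderivative u (k + 1) - antiderivative u k = u k := by
  unfold antiderivative
  rcases le_or_gt 0 k with hk | hk
  · lift k to ℕ using hk
    have h₁ : ((k : ℤ) + 1).toNat = k + 1 := by omega
    have h₂ : (-((k : ℤ) + 1)).toNat = 0 := by omega
    have h₃ : (-(k : ℤ)).toNat = 0 := by omega
    rw [h₁, h₂, h₃, Int.toNat_natCast, Finset.sum_range_succ]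
    simp
  · obtain ⟨n, rfl⟩ : ∃ n : ℕ, k = -1 - n := ⟨(-1 - k).toNat, by omega⟩
    have h₁ : (-1 - (n : ℤ) + 1).toNat = 0 := by omega
    have h₂ : (-(-1 - (n : ℤ) + 1)).toNat = n := by omega
    have h₃ : (-(-1 - (n : ℤ))).toNat = n + 1 := by omega
    have h₄ : (-1 - (n : ℤ)).toNat = 0 := by omega
    rw [h₁, h₂, h₃, h₄, Finset.sum_range_succ]
    simp

theorem map_antiderivative (φ : M →ₗ[ℤ] N) (u : ℤ → M) (k : ℤ) :
    φ (antiderivative u k) = antiderivative (fun j => φ (u j)) k := by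
  simp [antiderivative]

theorem antiderivative_add (u v : ℤ → M) (k : ℤ) :
    antiderivative (fun j => u j + v j) k = antiderivative u k + antiderivative v k := by
  simp only [antiderivative, Finset.sum_add_distrib]
  abel

theorem antiderivative_sub (u v : ℤ → M) (k : ℤ) :
    antiderivative (fun j => u j - v j) k = antiderivative u k - antiderivative v k := by
  simp only [antiderivative, Finset.sum_sub_distrib]
  abel

theorem antiderivative_smul (m : ℤ) (u : ℤ → M) (k : ℤ) :
    antiderivative (fun j => m • u j) k = m • antiderivative u k := by
  simp only [antiderivative, Finset.smul_sum, smul_sub]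

theorem antiderivative_sum {ι : Type} (s : Finset ι) (u : ι → ℤ → M) (k : ℤ) :
    antiderivative (fun j => ∑ i ∈ s, u i j) k = ∑ i ∈ s, antiderivative (u i) k := by
  simp only [antiderivative, Finset.sum_sub_distrib]
  rw [Finset.sum_comm, Finset.sum_comm (s := Finset.range (-k).toNat)]

theorem antiderivative_difference (v : ℤ → M) (k : ℤ) :
    antiderivative (fun j => v (j + 1) - v j) k = v k - v 0 := by
  induction k using Int.induction_on with
  | zero => simp [antiderivative]
  | succ n ih =>
    have h := antiderivative_succ (fun j => v (j + 1) - v j) n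
    rw [ih, sub_eq_iff_eq_add] at h
    rw [h]
    abel
  | pred n ih =>
    have h := antiderivative_succ (fun j => v (j + 1) - v j) (-(n : ℤ) - 1)
    rw [sub_add_cancel, ih, sub_eq_iff_eq_add] at h
    rw [← sub_eq_iff_eq_add'.mpr h]
    abel

end Antiderivative

/-! ### Acyclicity of the cubical complex of `ℤ^D` -/

/-- The sign of the face in direction `i` of a cell spanned by `S`. -/
def faceSign (i : Fin D) (S : Finset (Fin D)) : ℤ := (-1) ^ (S.filter fun j => j < i).card

theorem faceSign_mul_self (i : Fin D) (S : Finset (Fin D)) :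
    faceSign i S * faceSign i S = 1 := by
  rw [faceSign, ← pow_add, ← two_mul, pow_mul]
  simp

theorem faceSign_insert_self (i : Fin D) (S : Finset (Fin D)) :
    faceSign i (insert i S) = faceSign i S := by
  simp [faceSign, Finset.filter_insert]

theorem faceSign_erase_self (i : Fin D) (S : Finset (Fin D)) :
    faceSign i (S.erase i) = faceSign i S := by
  rw [faceSign, faceSign, Finset.filter_erase, Finset.erase_eq_of_notMem]
  simp

theorem faceSign_insert_of_gt {i j : Fin D} (hij : j < i) (S : Finset (Fin D)) :
    faceSign j (insert i S) = faceSign j S := by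
  simp [faceSign, Finset.filter_insert, hij.not_gt]

theorem faceSign_insert_of_lt {i j : Fin D} (hij : i < j) {S : Finset (Fin D)} (hi : i ∉ S) :
    faceSign j (insert i S) = -faceSign j S := by
  rw [faceSign, Finset.filter_insert, if_pos hij, Finset.card_insert_of_notMem (by simp [hi]),
    pow_succ, faceSign]
  ring

theorem faceSign_anticomm {i j : Fin D} {S : Finset (Fin D)} (hi : i ∉ S) (hj : j ∈ S) :
    faceSign i S * faceSign j (insert i S) = -(faceSign j S * faceSign i (S.erase j)) := by
  rcases lt_trichotomy i j with hij | rfl | hij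
  · rw [faceSign_insert_of_lt hij hi]
    have h := faceSign_insert_of_gt hij (S.erase j)
    rw [Finset.insert_erase hj] at h
    rw [h]
    ring
  · exact absurd hj hi
  · rw [faceSign_insert_of_gt hij]
    have h := faceSign_insert_of_lt hij (Finset.notMem_erase j S)
    rw [Finset.insert_erase hj] at h
    rw [h]
    ring

/-- The chain consisting of the cell `(z, S)`. -/
noncomputable def cellChain (z : Fin D → ℤ) (S : Finset (Fin D)) : CellChain D :=
  Finsupp.single (z, S) 1

theorem cellBoundary_eq (z : Fin D → ℤ) (S : Finset (Fin D)) :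
    cellBoundary (z, S) = ∑ i ∈ S, faceSign i S •
      (cellChain (z + Pi.single i 1) (S.erase i) - cellChain z (S.erase i)) := rfl

/-- The boundary homomorphism as a linear map. -/
noncomputable def boundaryMap (D : ℕ) : CellChain D →ₗ[ℤ] CellChain D :=
  Finsupp.linearCombination ℤ cellBoundary

/-- Projection of a cell to the hyperplane `z i = 0`. -/
noncomputable def projCell (i : Fin D) (cell : Cell D) : CellChain D :=
  if i ∈ cell.2 then 0 else cellChain (Function.update cell.1 i 0) cell.2

/-- The prism between a cell and its projection to the hyperplane `z i = 0`. -/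
noncomputable def prismCell (i : Fin D) (cell : Cell D) : CellChain D :=
  if i ∈ cell.2 then 0 else faceSign i cell.2 •
    antiderivative (fun k => cellChain (Function.update cell.1 i k) (insert i cell.2)) (cell.1 i)

/-- Linear extension of `projCell`. -/
noncomputable def projMap (i : Fin D) : CellChain D →ₗ[ℤ] CellChain D :=
  Finsupp.linearCombination ℤ (projCell i)

/-- Linear extension of `prismCell`. -/
noncomputable def prismMap (i : Fin D) : CellChain D →ₗ[ℤ] CellChain D :=
  Finsupp.linearCombination ℤ (prismCell i)

@[simp]
theorem boundaryMap_cellChain (z : Fin D → ℤ) (S : Finset (Fin D)) :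
    boundaryMap D (cellChain z S) = cellBoundary (z, S) := by
  simp [boundaryMap, cellChain]

@[simp]
theorem projMap_cellChain (i : Fin D) (z : Fin D → ℤ) (S : Finset (Fin D)) :
    projMap i (cellChain z S) = projCell i (z, S) := by
  simp [projMap, cellChain]

@[simp]
theorem prismMap_cellChain (i : Fin D) (z : Fin D → ℤ) (S : Finset (Fin D)) :
    prismMap i (cellChain z S) = prismCell i (z, S) := by
  simp [prismMap, cellChain]

theorem update_add_single_self (z : Fin D → ℤ) (i : Fin D) (k : ℤ) :
    Function.update (z + Pi.single i 1) i k = Function.update z i k := by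
  ext l
  by_cases h : l = i <;> simp [h]

theorem update_add_single_of_ne (z : Fin D → ℤ) {i j : Fin D} (hij : i ≠ j) (k : ℤ) :
    Function.update (z + Pi.single j 1) i k = Function.update z i k + Pi.single j 1 := by
  ext l
  by_cases h : l = i
  · subst h; simp [hij]
  · simp [h]

theorem update_self_add_single (z : Fin D → ℤ) (i : Fin D) (k : ℤ) :
    Function.update z i k + Pi.single i 1 = Function.update z i (k + 1) := by
  ext l
  by_cases h : l = i
  · subst h; simp
  · simp [h]

theorem boundaryMap_projCell (i : Fin D) (z : Fin D → ℤ) (S : Finset (Fin D)) :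
    boundaryMap D (projCell i (z, S)) = projMap i (cellBoundary (z, S)) := by
  by_cases hi : i ∈ S
  · rw [cellBoundary_eq, map_sum, projCell, if_pos hi, map_zero, Finset.sum_eq_zero]
    intro j _
    by_cases hij : i = j
    · subst hij
      simp [projCell, update_add_single_self]
    · simp [projCell, hi, hij]
  · rw [projCell, if_neg hi, boundaryMap_cellChain, cellBoundary_eq, cellBoundary_eq, map_sum]
    refine Finset.sum_congr rfl fun j hj => ?_
    have hij : i ≠ j := fun h => hi (h ▸ hj)
    simp [projCell, hi, update_add_single_of_ne z hij]

theorem boundary_prismCell_add (i : Fin D) (z : Fin D → ℤ) (S : Finset (Fin D)) :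
    boundaryMap D (prismCell i (z, S)) + prismMap i (cellBoundary (z, S)) =
      cellChain z S - projCell i (z, S) := by
  by_cases hi : i ∈ S
  · rw [prismCell, projCell, if_pos hi, if_pos hi, map_zero, zero_add, sub_zero,
      cellBoundary_eq, map_sum, Finset.sum_eq_single_of_mem i hi]
    · simp only [map_smul, map_sub, prismMap_cellChain, prismCell, Finset.notMem_erase, if_false,
        update_add_single_self, Finset.insert_erase hi, faceSign_erase_self]
      rw [← smul_sub, smul_smul, faceSign_mul_self, one_smul, Pi.add_apply, Pi.single_eq_same,
        antiderivative_succ, Function.update_eq_self]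
    · intro j _ hj
      simp [prismCell, hi, hj.symm]
  · have hcell (k : ℤ) : cellBoundary (Function.update z i k, insert i S) =
        faceSign i S • (cellChain (Function.update z i (k + 1)) S -
          cellChain (Function.update z i k) S) +
        ∑ j ∈ S, faceSign j (insert i S) •
          (cellChain (Function.update (z + Pi.single j 1) i k) (insert i (S.erase j)) -
            cellChain (Function.update z i k) (insert i (S.erase j))) := by
      rw [cellBoundary_eq, Finset.sum_insert hi, faceSign_insert_self, Finset.erase_insert hi,
        update_self_add_single]
      congr 1
      refine Finset.sum_congr rfl fun j hj => ?_
      have hij : i ≠ j := fun h => hi (h ▸ hj)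
      rw [Finset.erase_insert_of_ne hij, update_add_single_of_ne z hij]
    rw [prismCell, projCell, if_neg hi, if_neg hi, map_smul, map_antiderivative]
    simp only [boundaryMap_cellChain, hcell]
    rw [antiderivative_add, antiderivative_smul,
      antiderivative_difference (fun k => cellChain (Function.update z i k) S),
      antiderivative_sum, smul_add, smul_smul, faceSign_mul_self, one_smul,
      Function.update_eq_self, add_assoc, add_eq_left, cellBoundary_eq, map_sum,
      Finset.smul_sum, ← Finset.sum_add_distrib]
    refine Finset.sum_eq_zero fun j hj => ?_
    have hij : i ≠ j := fun h => hi (h ▸ hj)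
    have hi' : i ∉ S.erase j := fun h => hi (Finset.mem_of_mem_erase h)
    rw [antiderivative_smul, antiderivative_sub, smul_smul, faceSign_anticomm hi hj]
    simp only [map_smul, map_sub, prismMap_cellChain, prismCell, hi', if_false, Pi.add_apply,
      Pi.single_eq_of_ne hij, add_zero]
    rw [← smul_sub, smul_smul, neg_smul, neg_add_cancel]

theorem boundaryMap_projMap (i : Fin D) (ζ : CellChain D) :
    boundaryMap D (projMap i ζ) = projMap i (boundaryMap D ζ) := by
  have h : boundaryMap D ∘ₗ projMap i = projMap i ∘ₗ boundaryMap D := by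
    refine Finsupp.lhom_ext' fun cell => LinearMap.ext_ring ?_
    change boundaryMap D (projMap i (cellChain cell.1 cell.2)) =
      projMap i (boundaryMap D (cellChain cell.1 cell.2))
    rw [projMap_cellChain, boundaryMap_cellChain, boundaryMap_projCell]
  exact LinearMap.congr_fun h ζ

theorem boundary_prismMap_add (i : Fin D) (ζ : CellChain D) :
    boundaryMap D (prismMap i ζ) + prismMap i (boundaryMap D ζ) = ζ - projMap i ζ := by
  have h : boundaryMap D ∘ₗ prismMap i + prismMap i ∘ₗ boundaryMap D =
      LinearMap.id - projMap i := by
    refine Finsupp.lhom_ext' fun cell => LinearMap.ext_ring ?_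
    change boundaryMap D (prismMap i (cellChain cell.1 cell.2)) +
      prismMap i (boundaryMap D (cellChain cell.1 cell.2)) =
        cellChain cell.1 cell.2 - projMap i (cellChain cell.1 cell.2)
    rw [prismMap_cellChain, projMap_cellChain, boundaryMap_cellChain, boundary_prismCell_add]
  exact LinearMap.congr_fun h ζ

theorem linearCombination_mem_of_supported {α M : Type} [AddCommGroup M] {s : Set α} {v : α → M}
    {p : Submodule ℤ M} (hv : ∀ x ∈ s, v x ∈ p) {ζ : α →₀ ℤ}
    (hζ : ζ ∈ Finsupp.supported ℤ ℤ s) : Finsupp.linearCombination ℤ v ζ ∈ p := by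
  rw [Finsupp.linearCombination_apply]
  exact p.sum_mem fun x hx => p.smul_mem _ (hv x (hζ hx))

theorem cellChain_mem_supported {s : Set (Cell D)} {z : Fin D → ℤ} {S : Finset (Fin D)}
    (h : (z, S) ∈ s) : cellChain z S ∈ Finsupp.supported ℤ ℤ s :=
  Finsupp.single_mem_supported ℤ 1 h

theorem prismMap_mem_supported (i : Fin D) {d : ℕ} {ζ : CellChain D}
    (hζ : ζ ∈ Finsupp.supported ℤ ℤ {cell : Cell D | cell.2.card = d}) :
    prismMap i ζ ∈ Finsupp.supported ℤ ℤ {cell : Cell D | cell.2.card = d + 1} := by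
  refine linearCombination_mem_of_supported (fun cell hcell => ?_) hζ
  unfold prismCell
  split_ifs with hi
  · exact Submodule.zero_mem _
  · have h (k : ℤ) : cellChain (Function.update cell.1 i k) (insert i cell.2) ∈
        Finsupp.supported ℤ ℤ {cell : Cell D | cell.2.card = d + 1} := by
      refine cellChain_mem_supported ?_
      rw [Set.mem_ofPred_eq, Finset.card_insert_of_notMem hi, hcell]
    exact Submodule.smul_mem _ _ (Submodule.sub_mem _ (Submodule.sum_mem _ fun _ _ => h _)
      (Submodule.sum_mem _ fun _ _ => h _))

theorem projMap_mem_supported (i : Fin D) {d : ℕ} {T : Finset (Fin D)} {ζ : CellChain D}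
    (hζ : ζ ∈ Finsupp.supported ℤ ℤ {cell : Cell D | cell.2.card = d ∧ Disjoint T cell.2}) :
    projMap i ζ ∈
      Finsupp.supported ℤ ℤ {cell : Cell D | cell.2.card = d ∧ Disjoint (insert i T) cell.2} := by
  refine linearCombination_mem_of_supported (fun cell hcell => ?_) hζ
  unfold projCell
  split_ifs with hi
  · exact Submodule.zero_mem _
  · exact cellChain_mem_supported ⟨hcell.1, Finset.disjoint_insert_left.mpr ⟨hi, hcell.2⟩⟩

/-- Every cycle of positive dimension in the cubical complex of `ℤ^D` is a boundary. -/
theorem exists_boundaryMap_eq_of_cycle {d : ℕ} (hd : 1 ≤ d) {ζ : CellChain D}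
    (hζ : ζ ∈ Finsupp.supported ℤ ℤ {cell : Cell D | cell.2.card = d})
    (hcycle : boundaryMap D ζ = 0) :
    ∃ β ∈ Finsupp.supported ℤ ℤ {cell : Cell D | cell.2.card = d + 1}, boundaryMap D β = ζ := by
  have key : ∀ T : Finset (Fin D), ∃ β ∈ Finsupp.supported ℤ ℤ {cell : Cell D | cell.2.card = d + 1},
      ζ - boundaryMap D β ∈
        Finsupp.supported ℤ ℤ {cell : Cell D | cell.2.card = d ∧ Disjoint T cell.2} ∧
      boundaryMap D (ζ - boundaryMap D β) = 0 := by
    intro T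
    induction T using Finset.induction_on with
    | empty => exact ⟨0, Submodule.zero_mem _, by simpa using hζ, by simpa using hcycle⟩
    | insert i T _ ih =>
      obtain ⟨β, hβ, hsupp, hbd⟩ := ih
      set ξ := ζ - boundaryMap D β with hξ
      have hhom := boundary_prismMap_add i ξ
      rw [hbd, map_zero, add_zero] at hhom
      have heq : ζ - boundaryMap D (β + prismMap i ξ) = projMap i ξ := by
        rw [map_add, hhom, hξ]
        abel
      refine ⟨β + prismMap i ξ, Submodule.add_mem _ hβ (prismMap_mem_supported i
        (Finsupp.supported_mono (fun _ h => h.1) hsupp)), ?_, ?_⟩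
      · rw [heq]
        exact projMap_mem_supported i hsupp
      · rw [heq, boundaryMap_projMap, hbd, map_zero]
  obtain ⟨β, hβ, hsupp, -⟩ := key Finset.univ
  refine ⟨β, hβ, (sub_eq_zero.mp ?_).symm⟩
  have hempty : {cell : Cell D | cell.2.card = d ∧ Disjoint Finset.univ cell.2} = ∅ := by
    refine Set.eq_empty_of_forall_notMem fun cell hcell => ?_
    have h0 : cell.2 = ∅ := by simpa using disjoint_top.mp hcell.2.symm
    have hcard := hcell.1
    rw [h0, Finset.card_empty] at hcard
    omega
  rw [hempty, Finsupp.supported_empty] at hsupp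
  exact (Submodule.mem_bot ℤ).mp hsupp

/-! ### Values of equivariant cocycles on cycles -/

/-- An equivariant `d`-cocycle vanishes on all `d`-cycles over admissible configurations. -/
theorem IsEqDCocycle.chainVal_eq_zero {G : Type} [AddCommGroup G] {𝔄 : Set (Config D A)}
    {d r : ℕ} {c : Finset (Fin D) → (ballZ D r → A) → G} (hc : IsEqDCocycle 𝔄 d r c)
    (hd : 1 ≤ d) {a : Config D A} (ha : a ∈ 𝔄) {ζ : CellChain D}
    (hζ : ∀ cell ∈ ζ.support, (cell : Cell D).2.card = d) (hcycle : chainBoundary ζ = 0) :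
    chainVal c a ζ = 0 := by
  obtain ⟨β, hβ, rfl⟩ := exists_boundaryMap_eq_of_cycle hd (ζ := ζ) hζ hcycle
  let φ : CellChain D →ₗ[ℤ] G :=
    Finsupp.linearCombination ℤ fun cell : Cell D => c cell.2 (blockAt r a cell.1)
  change φ (boundaryMap D β) = 0
  rw [boundaryMap, Finsupp.apply_linearCombination]
  exact (Submodule.mem_bot ℤ).mp
    (linearCombination_mem_of_supported (fun cell hcell => hc a ha cell hcell) hβ)

theorem add_mem_goodSet [TopologicalSpace A] {𝔄 : Set (Config D A)} (h𝔄 : IsSubshift 𝔄)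
    {r s : ℕ} {a : Config D A} {z w : Fin D → ℤ} (hz : z ∈ goodSet 𝔄 (s + r) a)
    (hw : w ∈ ballZ D r) : z + w ∈ goodSet 𝔄 s a := by
  obtain ⟨b, hb, hblock⟩ := hz
  refine ⟨shift w b, h𝔄.2.2 w ▸ Set.mem_image_of_mem _ hb, funext fun v => ?_⟩
  have hmem : w + v.1 ∈ ballZ D (s + r) := fun i => by
    have h₁ := hw i
    have h₂ := v.2 i
    have h₃ := abs_add_le (w i) (v.1 i)
    rw [Pi.add_apply]
    push_cast
    omega
  have h := congr_fun hblock ⟨w + v.1, hmem⟩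
  simp only [blockAt, shift, zero_add] at h ⊢
  rw [add_comm v.1 w, h, add_assoc]

theorem statement_19 {D : ℕ} (hD : 1 ≤ D) {A : Type} [Fintype A] [Nonempty A]
    [TopologicalSpace A] [DiscreteTopology A]
    (𝔄 : Set (Config D A)) (h𝔄 : IsSubshift 𝔄)
    {G : Type} [AddCommGroup G] (d : ℕ) (hd1 : 1 ≤ d) (hdD : d ≤ D)
    (a : Config D A) (ha : a ∈ almostAdmissible 𝔄)
    (hpole : HasProjDPole G 𝔄 d a) :
    ¬ Removable 𝔄 a := by
  rintro ⟨s, a', ha', hagree⟩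
  obtain ⟨r, c, hc, hpole⟩ := hpole
  obtain ⟨ζ, hcard, hcycle, hgood, hval⟩ := hpole (s + r) (Nat.le_add_left r s)
  refine hval ?_
  rw [← hc.chainVal_eq_zero hd1 ha' hcard hcycle]
  refine Finsupp.sum_congr fun cell hcell => ?_
  have hblock : blockAt r a cell.1 = blockAt r a' cell.1 :=
    funext fun w => (hagree _ (add_mem_goodSet h𝔄 (hgood cell hcell) w.2)).symm
  rw [hblock]

end Defects
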